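/- Let α ∈ (0,2), K > 0, and let s : ℝ → ℝ be twice continuously differentiable with s(x) ≠ 0 for all x and with bounded first and second derivatives. For a twice continuously differentiable, compactly supported f : ℝ → ℝ define D^α f(x) = K ∫_ℝ ( f(x+z) − f(x) − 1_{{|z|≤1}} z f'(x) ) |z|^{−1−α} dz. Then for all twice continuously differentiable, compactly supported φ, ψ : ℝ → ℝ, ∫_ℝ ψ(x) [ K ∫_ℝ ( φ(x+s(x)y) − φ(x) − 1_{{|y|≤1}} s(x) y φ'(x) ) |y|^{−1−α} dy ] dx = ∫_ℝ φ(x) · D^α( |s|^α ψ )(x) dx, all integrals being absolutely convergent. -/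

import Mathlib

open MeasureTheory

/-- The fractional Laplacian (of order `α`, with constant `K`) of `f : ℝ → ℝ`:
`D^α f(x) = K ∫ (f(x+z) − f(x) − 1_{|z|≤1} z f'(x)) |z|^{−1−α} dz`. -/
noncomputable def fracLap (α K : ℝ) (f : ℝ → ℝ) (x : ℝ) : ℝ :=
  K * ∫ z : ℝ,
    (f (x + z) - f x - (if |z| ≤ 1 then (1 : ℝ) else 0) * z * deriv f x)
      * |z| ^ (-(1 + α))

lemma aux_weight_integrable {α : ℝ} (hα : α ∈ Set.Ioo (0 : ℝ) 2) :
    Integrable (fun y : ℝ => min 1 (y ^ 2) * |y| ^ (-(1 + α))) := by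
  have hpos : IntegrableOn (fun y : ℝ => min 1 (y ^ 2) * |y| ^ (-(1 + α))) (Set.Ioi 0) := by
    rw [← Set.Ioc_union_Ioi_eq_Ioi (zero_le_one : (0:ℝ) ≤ 1)]
    refine IntegrableOn.union ?_ ?_
    · have h1 : IntegrableOn (fun y : ℝ => y ^ (1 - α)) (Set.Ioc 0 1) := by
        rw [← intervalIntegrable_iff_integrableOn_Ioc_of_le zero_le_one]
        exact intervalIntegral.intervalIntegrable_rpow' (by linarith [hα.2])
      refine h1.congr_fun (fun y hy => ?_) measurableSet_Ioc
      have hy0 : 0 < y := hy.1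
      have : y ^ 2 ≤ 1 := by nlinarith [hy.2, hy.1]
      simp only
      rw [min_eq_right this, abs_of_pos hy0, ← Real.rpow_natCast, ← Real.rpow_add hy0]
      congr 1
      push_cast; ring
    · refine (integrableOn_Ioi_rpow_of_lt (a := -(1 + α)) (by linarith [hα.1])
        zero_lt_one).congr_fun (fun y hy => ?_) measurableSet_Ioi
      have hy1 : (1:ℝ) < y := hy
      have : 1 ≤ y ^ 2 := by nlinarith
      simp only
      rw [min_eq_left this, abs_of_pos (by linarith), one_mul]
  have hneg : IntegrableOn (fun y : ℝ => min 1 (y ^ 2) * |y| ^ (-(1 + α))) (Set.Iic 0) := by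
    rw [← Measure.map_neg_eq_self (volume : Measure ℝ)]
    let m : MeasurableEmbedding fun x : ℝ => -x := (Homeomorph.neg ℝ).measurableEmbedding
    rw [m.integrableOn_map_iff]
    simp_rw [Function.comp_def, abs_neg, Set.neg_preimage, Set.neg_Iic, neg_zero, neg_sq]
    exact Iff.mpr integrableOn_Ici_iff_integrableOn_Ioi hpos
  have := hneg.union hpos
  rwa [Set.Iic_union_Ioi, integrableOn_univ] at this

lemma aux_meas_weight (α : ℝ) : Measurable (fun y : ℝ => |y| ^ (-(1 + α))) := by
  fun_prop

lemma aux_integrable_of_bound {α : ℝ} (hα : α ∈ Set.Ioo (0 : ℝ) 2) {F : ℝ → ℝ}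
    (hF : Measurable F) {C : ℝ} (hC : ∀ y, |F y| ≤ C * min 1 (y ^ 2)) :
    Integrable (fun y : ℝ => F y * |y| ^ (-(1 + α))) := by
  refine ((aux_weight_integrable hα).const_mul C).mono'
    (hF.mul (aux_meas_weight α)).aestronglyMeasurable (Filter.Eventually.of_forall fun y => ?_)
  have hw : 0 ≤ |y| ^ (-(1 + α)) := Real.rpow_nonneg (abs_nonneg _) _
  rw [Real.norm_eq_abs, abs_mul, abs_of_nonneg hw, ← mul_assoc]
  exact mul_le_mul_of_nonneg_right (hC y) hw

lemma aux_bounds {f : ℝ → ℝ} (hf : ContDiff ℝ 2 f) (hfs : HasCompactSupport f) :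
    ∃ B : ℝ, 0 ≤ B ∧ (∀ x, |f x| ≤ B) ∧ (∀ x z, |f (x + z) - f x - z * deriv f x| ≤ B * z ^ 2) := by
  have hd : ContDiff ℝ 1 (deriv f) := by
    have h : ContDiff ℝ (1 + 1) f := by simpa [one_add_one_eq_two] using hf
    exact (contDiff_succ_iff_deriv.1 h).2.2
  have hdd : Continuous (deriv (deriv f)) := hd.continuous_deriv le_rfl
  obtain ⟨B0, hB0⟩ := hfs.exists_bound_of_continuous hf.continuous
  obtain ⟨B2, hB2⟩ := (hfs.deriv.deriv).exists_bound_of_continuous hdd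
  have hB0' : 0 ≤ B0 := (norm_nonneg _).trans (hB0 0)
  have hB2' : 0 ≤ B2 := (norm_nonneg _).trans (hB2 0)
  have hfd : Differentiable ℝ f := hf.differentiable (by norm_num)
  have hdd' : Differentiable ℝ (deriv f) := hd.differentiable (by norm_num)
  refine ⟨B0 + B2, by positivity, fun x => ?_, fun x z => ?_⟩
  · have := hB0 x
    rw [Real.norm_eq_abs] at this
    linarith
  · have lip : ∀ u, |deriv f (x + u) - deriv f x| ≤ B2 * |u| := by
      intro u
      have := Convex.norm_image_sub_le_of_norm_deriv_le (f := deriv f) (s := Set.univ) (C := B2)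
        (fun y _ => hdd' y) (fun y _ => hB2 y) convex_univ (Set.mem_univ x) (Set.mem_univ (x + u))
      simpa [Real.norm_eq_abs] using this
    have hder : ∀ u, HasDerivAt (fun u => f (x + u) - u * deriv f x)
        (deriv f (x + u) - deriv f x) u := by
      intro u
      have h1 : HasDerivAt (fun u => f (x + u)) (deriv f (x + u)) u :=
        (hfd (x + u)).hasDerivAt.comp_const_add x u
      have h2 : HasDerivAt (fun u : ℝ => u * deriv f x) (deriv f x) u := by
        simpa using (hasDerivAt_id u).mul_const (deriv f x)
      exact h1.sub h2
    have := Convex.norm_image_sub_le_of_norm_hasDerivWithin_le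
      (f := fun u => f (x + u) - u * deriv f x) (f' := fun u => deriv f (x + u) - deriv f x)
      (s := Set.Icc (-|z|) |z|) (C := B2 * |z|) (x := 0) (y := z)
      (fun u _ => (hder u).hasDerivWithinAt)
      (fun u hu => (lip u).trans (mul_le_mul_of_nonneg_left (abs_le.2 hu) hB2'))
      (convex_Icc _ _) ⟨by simp, by simp⟩ ⟨neg_abs_le z, le_abs_self z⟩
    simp only [Real.norm_eq_abs, add_zero, zero_mul, sub_zero] at this
    have e : f (x + z) - f x - z * deriv f x = f (x + z) - z * deriv f x - f x := by ring
    rw [e]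
    refine this.trans ?_
    rw [mul_assoc, abs_mul_abs_self]
    nlinarith [mul_nonneg hB0' (sq_nonneg z)]

lemma aux_integrable_first {α : ℝ} (hα : α ∈ Set.Ioo (0 : ℝ) 2) {f : ℝ → ℝ}
    (hf : ContDiff ℝ 2 f) (hfs : HasCompactSupport f) (x c : ℝ) :
    Integrable (fun y : ℝ =>
      (f (x + c * y) - f x - (if |y| ≤ 1 then (1 : ℝ) else 0) * (c * y) * deriv f x)
        * |y| ^ (-(1 + α))) := by
  obtain ⟨B, hB, h0, h2⟩ := aux_bounds hf hfs
  have hm : Measurable f := hf.continuous.measurable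
  refine aux_integrable_of_bound hα (C := B * c ^ 2 + 2 * B) ?_ (fun y => ?_)
  · have : Measurable (fun y : ℝ => if |y| ≤ 1 then (1 : ℝ) else 0) :=
      Measurable.ite (measurableSet_le (by fun_prop) (by fun_prop)) measurable_const
        measurable_const
    fun_prop
  · split_ifs with hy
    · have : y ^ 2 ≤ 1 := by rw [← sq_abs]; nlinarith [abs_nonneg y]
      rw [min_eq_right this, one_mul]
      refine (h2 x (c * y)).trans ?_
      nlinarith [mul_nonneg hB (sq_nonneg y)]
    · have : 1 ≤ y ^ 2 := by rw [← sq_abs]; nlinarith [abs_nonneg y]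
      rw [min_eq_left this]
      have a := abs_le.1 (h0 (x + c * y))
      have b := abs_le.1 (h0 x)
      have := mul_nonneg hB (sq_nonneg c)
      rw [abs_le]
      constructor <;> nlinarith [a.1, a.2, b.1, b.2]

/-- symmetric second difference integral -/
noncomputable def symLap (α : ℝ) (f : ℝ → ℝ) (x : ℝ) : ℝ :=
  ∫ z : ℝ, (f (x + z) + f (x - z) - 2 * f x) * |z| ^ (-(1 + α))

lemma aux_first_eq_sym {α : ℝ} (hα : α ∈ Set.Ioo (0 : ℝ) 2) {f : ℝ → ℝ}
    (hf : ContDiff ℝ 2 f) (hfs : HasCompactSupport f) (x c : ℝ) (hc : c ≠ 0) :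
    ∫ y : ℝ,
      (f (x + c * y) - f x - (if |y| ≤ 1 then (1 : ℝ) else 0) * (c * y) * deriv f x)
        * |y| ^ (-(1 + α)) = |c| ^ α * (symLap α f x / 2) := by
  have hi := aux_integrable_first hα hf hfs x c
  have hi' := hi.comp_neg
  have hn := integral_neg_eq_self (fun y : ℝ =>
      (f (x + c * y) - f x - (if |y| ≤ 1 then (1 : ℝ) else 0) * (c * y) * deriv f x)
        * |y| ^ (-(1 + α))) volume
  have hadd := integral_add hi hi'
  rw [hn] at hadd
  have hs := Measure.integral_comp_mul_left
    (fun z : ℝ => (f (x + z) + f (x - z) - 2 * f x) * |z| ^ (-(1 + α))) c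
  have hcp : 0 < |c| := abs_pos.2 hc
  have e : ∀ y : ℝ, (f (x + c * y) + f (x - c * y) - 2 * f x) * |c * y| ^ (-(1 + α))
      = |c| ^ (-(1 + α)) * ((f (x + c * y) + f (x - c * y) - 2 * f x) * |y| ^ (-(1 + α))) := by
    intro y
    rw [abs_mul, Real.mul_rpow (abs_nonneg _) (abs_nonneg _)]; ring
  simp_rw [e] at hs
  rw [integral_const_mul, smul_eq_mul] at hs
  have e2 : ∫ y : ℝ, ((f (x + c * y) - f x - (if |y| ≤ 1 then (1 : ℝ) else 0) * (c * y) * deriv f x)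
        * |y| ^ (-(1 + α)) + (f (x + c * -y) - f x - (if |-y| ≤ 1 then (1 : ℝ) else 0) * (c * -y)
        * deriv f x) * |-y| ^ (-(1 + α)))
      = ∫ y : ℝ, (f (x + c * y) + f (x - c * y) - 2 * f x) * |y| ^ (-(1 + α)) := by
    congr 1; ext y
    rw [abs_neg, show x + c * -y = x - c * y by ring]; ring
  rw [e2] at hadd
  have e3 : ∫ y : ℝ, (f (x + c * y) + f (x - c * y) - 2 * f x) * |y| ^ (-(1 + α))
      = |c| ^ α * symLap α f x := by
    have hcc : |c| ^ (-(1 + α)) * (|c| ^ α * |c|) = 1 := by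
      nth_rewrite 3 [← Real.rpow_one |c|]
      rw [← Real.rpow_add hcp, ← Real.rpow_add hcp,
        show -(1 + α) + (α + 1) = 0 by ring, Real.rpow_zero]
    rw [abs_inv] at hs
    set J := ∫ y : ℝ, (f (x + c * y) + f (x - c * y) - 2 * f x) * |y| ^ (-(1 + α))
    change _ = |c|⁻¹ * symLap α f x at hs
    calc J = (|c| ^ (-(1 + α)) * (|c| ^ α * |c|)) * J := by rw [hcc, one_mul]
      _ = |c| ^ α * |c| * (|c| ^ (-(1 + α)) * J) := by ring
      _ = |c| ^ α * (|c| * |c|⁻¹) * symLap α f x := by rw [hs]; ring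
      _ = _ := by rw [mul_inv_cancel₀ hcp.ne', mul_one]
  rw [e3] at hadd
  linarith

lemma aux_prod_integrable {α : ℝ} (hα : α ∈ Set.Ioo (0 : ℝ) 2) {f g : ℝ → ℝ}
    (hf : ContDiff ℝ 2 f) (hfs : HasCompactSupport f)
    (hg : Continuous g) (hgs : HasCompactSupport g) :
    Integrable (fun p : ℝ × ℝ => g p.1 * ((f (p.1 + p.2) + f (p.1 - p.2) - 2 * f p.1)
      * |p.2| ^ (-(1 + α)))) (volume.prod volume) := by
  obtain ⟨B, hB, h0, h2⟩ := aux_bounds hf hfs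
  have hm : Measurable f := hf.continuous.measurable
  have hgm : Measurable g := hg.measurable
  have hb := (hg.integrable_of_hasCompactSupport hgs (μ := volume)).norm.mul_prod
    ((aux_weight_integrable hα).const_mul (4 * B))
  refine hb.mono' (Measurable.aestronglyMeasurable (by fun_prop))
    (Filter.Eventually.of_forall fun p => ?_)
  obtain ⟨x, z⟩ := p
  have hw : 0 ≤ |z| ^ (-(1 + α)) := Real.rpow_nonneg (abs_nonneg _) _
  simp only [norm_mul]
  refine mul_le_mul_of_nonneg_left ?_ (norm_nonneg _)
  rw [Real.norm_eq_abs, Real.norm_eq_abs, abs_of_nonneg hw, ← mul_assoc]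
  refine mul_le_mul_of_nonneg_right ?_ hw
  rw [mul_min_of_nonneg _ _ (by positivity)]
  refine le_min ?_ ?_
  · have a := abs_le.1 (h0 (x + z))
    have a' := abs_le.1 (h0 (x - z))
    have b := abs_le.1 (h0 x)
    rw [abs_le]
    constructor <;> linarith [a.1, a.2, b.1, b.2, a'.1, a'.2]
  · have a := abs_le.1 (h2 x z)
    have b := abs_le.1 (h2 x (-z))
    rw [← sub_eq_add_neg] at b
    have := mul_nonneg hB (sq_nonneg z)
    rw [abs_le]
    constructor <;> nlinarith [a.1, a.2, b.1, b.2]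

lemma aux_outer_integrable {α : ℝ} (hα : α ∈ Set.Ioo (0 : ℝ) 2) {f g : ℝ → ℝ}
    (hf : ContDiff ℝ 2 f) (hfs : HasCompactSupport f)
    (hg : Continuous g) (hgs : HasCompactSupport g) :
    Integrable (fun x => g x * symLap α f x) := by
  have := (aux_prod_integrable hα hf hfs hg hgs).integral_prod_left
  simpa only [integral_const_mul, symLap] using this

lemma aux_translate {f g : ℝ → ℝ} (hf : Continuous f) (hg : Continuous g)
    (hfs : HasCompactSupport f) (z : ℝ) :
    ∫ x, g x * (f (x + z) + f (x - z) - 2 * f x) = ∫ x, f x * (g (x + z) + g (x - z) - 2 * g x) := by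
  have i1 : Integrable (fun x => f x * g (x + z)) :=
    (by fun_prop : Continuous (fun x => f x * g (x + z))).integrable_of_hasCompactSupport
      hfs.mul_right
  have i2 : Integrable (fun x => f x * g (x - z)) :=
    (by fun_prop : Continuous (fun x => f x * g (x - z))).integrable_of_hasCompactSupport
      hfs.mul_right
  have i3 : Integrable (fun x => 2 * (f x * g x)) :=
    ((by fun_prop : Continuous (fun x => f x * g x)).integrable_of_hasCompactSupport
      hfs.mul_right).const_mul 2
  have j1 : Integrable (fun x => g x * f (x + z)) := by
    refine (i2.comp_add_right z).congr (Filter.Eventually.of_forall fun x => ?_)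
    simp [mul_comm]
  have j2 : Integrable (fun x => g x * f (x - z)) := by
    refine (i1.comp_sub_right z).congr (Filter.Eventually.of_forall fun x => ?_)
    simp [mul_comm]
  have k1 : ∫ x, g x * f (x + z) = ∫ x, f x * g (x - z) := by
    rw [← integral_add_right_eq_self (fun x => f x * g (x - z)) z]
    congr 1; ext x; simp [mul_comm]
  have k2 : ∫ x, g x * f (x - z) = ∫ x, f x * g (x + z) := by
    rw [← integral_sub_right_eq_self (fun x => f x * g (x + z)) z]
    congr 1; ext x; simp [mul_comm]
  calc ∫ x, g x * (f (x + z) + f (x - z) - 2 * f x)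
      = ∫ x, (g x * f (x + z) + g x * f (x - z) - 2 * (f x * g x)) := by
        congr 1; ext x; ring
    _ = (∫ x, f x * g (x - z)) + (∫ x, f x * g (x + z)) - ∫ x, 2 * (f x * g x) := by
        rw [integral_sub (by exact j1.add j2) i3, integral_add j1 j2, k1, k2]
    _ = ∫ x, (f x * g (x + z) + f x * g (x - z) - 2 * (f x * g x)) := by
        rw [integral_sub (by exact i1.add i2) i3, integral_add i1 i2]; ring
    _ = _ := by congr 1; ext x; ring

lemma aux_selfadj {α : ℝ} (hα : α ∈ Set.Ioo (0 : ℝ) 2) {f g : ℝ → ℝ}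
    (hf : ContDiff ℝ 2 f) (hfs : HasCompactSupport f)
    (hg : ContDiff ℝ 2 g) (hgs : HasCompactSupport g) :
    ∫ x, g x * symLap α f x = ∫ x, f x * symLap α g x := by
  have h1 := integral_integral_swap (μ := volume) (ν := volume) (f := fun x z : ℝ => g x *
    ((f (x + z) + f (x - z) - 2 * f x) * |z| ^ (-(1 + α))))
    (aux_prod_integrable hα hf hfs hg.continuous hgs)
  have h2 := integral_integral_swap (μ := volume) (ν := volume) (f := fun x z : ℝ => f x *
    ((g (x + z) + g (x - z) - 2 * g x) * |z| ^ (-(1 + α))))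
    (aux_prod_integrable hα hg hgs hf.continuous hfs)
  simp only [integral_const_mul] at h1 h2
  unfold symLap
  rw [h1, h2]
  congr 1; ext z
  simp only [← mul_assoc]
  rw [integral_mul_const, integral_mul_const,
    aux_translate hf.continuous hg.continuous hfs z]

/-- Adjoint identity: for `α ∈ (0,2)`, `K > 0`, a nonvanishing `C²` function `s` with bounded
first and second derivatives, and `C²` compactly supported `φ, ψ`,
`∫ ψ(x) [K ∫ (φ(x+s(x)y) − φ(x) − 1_{|y|≤1} s(x)y φ'(x)) |y|^{−1−α} dy] dx
  = ∫ φ(x) D^α(|s|^α ψ)(x) dx`, all integrals being absolutely convergent. -/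
theorem adjoint_generator_fracLap (α K : ℝ) (hα : α ∈ Set.Ioo (0 : ℝ) 2) (hK : 0 < K)
    (s : ℝ → ℝ) (hs : ContDiff ℝ 2 s) (hs0 : ∀ x, s x ≠ 0)
    (hsbdd : ∃ M : ℝ, ∀ x, |deriv s x| ≤ M ∧ |deriv (deriv s) x| ≤ M)
    (φ ψ : ℝ → ℝ) (hφ : ContDiff ℝ 2 φ) (hφsupp : HasCompactSupport φ)
    (hψ : ContDiff ℝ 2 ψ) (hψsupp : HasCompactSupport ψ) :
    (∀ x : ℝ, Integrable (fun y : ℝ =>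
      (φ (x + s x * y) - φ x - (if |y| ≤ 1 then (1 : ℝ) else 0) * (s x * y) * deriv φ x)
        * |y| ^ (-(1 + α)))) ∧
    (∀ x : ℝ, Integrable (fun z : ℝ =>
      ((|s (x + z)| ^ α * ψ (x + z)) - |s x| ^ α * ψ x
          - (if |z| ≤ 1 then (1 : ℝ) else 0) * z * deriv (fun u => |s u| ^ α * ψ u) x)
        * |z| ^ (-(1 + α)))) ∧
    Integrable (fun x : ℝ => ψ x * (K * ∫ y : ℝ,
      (φ (x + s x * y) - φ x - (if |y| ≤ 1 then (1 : ℝ) else 0) * (s x * y) * deriv φ x)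
        * |y| ^ (-(1 + α)))) ∧
    Integrable (fun x : ℝ => φ x * fracLap α K (fun u => |s u| ^ α * ψ u) x) ∧
    ∫ x : ℝ, ψ x * (K * ∫ y : ℝ,
        (φ (x + s x * y) - φ x - (if |y| ≤ 1 then (1 : ℝ) else 0) * (s x * y) * deriv φ x)
          * |y| ^ (-(1 + α)))
      = ∫ x : ℝ, φ x * fracLap α K (fun u => |s u| ^ α * ψ u) x := by
  have habs : ContDiff ℝ 2 (fun u => |s u|) := by
    rw [contDiff_iff_contDiffAt]
    intro x
    exact (contDiffAt_abs (hs0 x)).comp x hs.contDiffAt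
  have hg : ContDiff ℝ 2 (fun u => |s u| ^ α * ψ u) :=
    (habs.rpow_const_of_ne (fun x => abs_ne_zero.2 (hs0 x))).mul hψ
  have hgs : HasCompactSupport (fun u => |s u| ^ α * ψ u) := hψsupp.mul_left
  have e1 : (fun x : ℝ => ψ x * (K * ∫ y : ℝ,
      (φ (x + s x * y) - φ x - (if |y| ≤ 1 then (1 : ℝ) else 0) * (s x * y) * deriv φ x)
        * |y| ^ (-(1 + α)))) =
      fun x => (K / 2) * ((|s x| ^ α * ψ x) * symLap α φ x) := by
    ext x
    rw [aux_first_eq_sym hα hφ hφsupp x (s x) (hs0 x)]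
    ring
  have e2 : (fun x : ℝ => φ x * fracLap α K (fun u => |s u| ^ α * ψ u) x) =
      fun x => (K / 2) * (φ x * symLap α (fun u => |s u| ^ α * ψ u) x) := by
    ext x
    have := aux_first_eq_sym hα hg hgs x 1 one_ne_zero
    simp only [one_mul, abs_one, Real.one_rpow] at this
    unfold fracLap
    rw [this]
    ring
  refine ⟨fun x => aux_integrable_first hα hφ hφsupp x (s x), fun x => ?_, ?_, ?_, ?_⟩
  · simpa only [one_mul] using aux_integrable_first hα hg hgs x 1
  · rw [e1]
    exact (aux_outer_integrable hα hφ hφsupp hg.continuous hgs).const_mul _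
  · rw [e2]
    exact (aux_outer_integrable hα hg hgs hφ.continuous hφsupp).const_mul _
  · rw [e1, e2, integral_const_mul, integral_const_mul, aux_selfadj hα hφ hφsupp hg hgs]
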